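/- arXiv:2507.01618 — 2 statements merged into one kernel-verified Lean document; each statement's English description precedes it below -/
import Mathlib

section
/- Let d ∈ ℕ, let Ω ⊆ ℝ^d be open and let I ⊆ ℝ be an open interval. Let ε > 0, let F : ℝ → ℝ be continuously differentiable, let u : I × Ω → ℝ^d be continuously differentiable with div u = 0 on I × Ω, and let φ : I × Ω → ℝ be twice continuously differentiable (jointly in time and space). Define the free energy density f := (ε/2)|∇φ|² + ε⁻¹ F(φ), the chemical potential μ := −ε Δφ + ε⁻¹ F′(φ), and the material derivative ∂_t^•φ := ∂_t φ + u · ∇φ. Then ∂_t f + div(f u) = μ ∂_t^•φ + div(ε ∂_t^•φ ∇φ) − ε (∇φ ⊗ ∇φ) : ∇u on I × Ω. -/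
noncomputable section

open scoped BigOperators

/-- Spatial partial derivative `∂ₖ f x`. -/
def pd {d : ℕ} (k : Fin d) (f : EuclideanSpace ℝ (Fin d) → ℝ)
    (x : EuclideanSpace ℝ (Fin d)) : ℝ :=
  fderiv ℝ f x (EuclideanSpace.single k 1)

/-- Spatial divergence of a vector field given by its components. -/
def div' {d : ℕ} (w : Fin d → EuclideanSpace ℝ (Fin d) → ℝ)
    (x : EuclideanSpace ℝ (Fin d)) : ℝ :=
  ∑ k, pd k (w k) x

/-- Laplacian `Δf x = ∑ₖ ∂ₖ∂ₖ f x`. -/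
def lap' {d : ℕ} (f : EuclideanSpace ℝ (Fin d) → ℝ)
    (x : EuclideanSpace ℝ (Fin d)) : ℝ :=
  ∑ k, pd k (pd k f) x

theorem aux_pd {d : ℕ} (g : ℝ × EuclideanSpace ℝ (Fin d) → ℝ)
    (G : ℝ × EuclideanSpace ℝ (Fin d) →L[ℝ] ℝ) (t : ℝ) (x : EuclideanSpace ℝ (Fin d))
    (h : HasFDerivAt g G (t, x)) (k : Fin d) (w : EuclideanSpace ℝ (Fin d) → ℝ)
    (hw : ∀ᶠ y in nhds x, w y = g (t, y)) :
    pd k w x = G (0, EuclideanSpace.single k 1) := by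
  have h1 : HasFDerivAt (fun y : EuclideanSpace ℝ (Fin d) => g (t, y))
      (G.comp (ContinuousLinearMap.inr ℝ ℝ (EuclideanSpace ℝ (Fin d)))) x :=
    HasFDerivAt.comp x h (hasFDerivAt_prodMk_right t x)
  have h2 := h1.congr_of_eventuallyEq hw
  unfold pd
  rw [h2.fderiv]
  simp

theorem aux_dt {d : ℕ} (g : ℝ × EuclideanSpace ℝ (Fin d) → ℝ)
    (G : ℝ × EuclideanSpace ℝ (Fin d) →L[ℝ] ℝ) (t : ℝ) (x : EuclideanSpace ℝ (Fin d))
    (h : HasFDerivAt g G (t, x)) (w : ℝ → ℝ)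
    (hw : ∀ᶠ s in nhds t, w s = g (s, x)) :
    deriv w t = G (1, 0) := by
  have h1 : HasFDerivAt (fun s : ℝ => g (s, x))
      (G.comp (ContinuousLinearMap.inl ℝ ℝ (EuclideanSpace ℝ (Fin d)))) t :=
    HasFDerivAt.comp t h (hasFDerivAt_prodMk_left t x)
  have h2 := h1.congr_of_eventuallyEq hw
  rw [h2.hasDerivAt.deriv]
  simp

theorem aux_alg {d : ℕ} (ε c F' T M fv : ℝ) (a u Tk : Fin d → ℝ) (h U : Fin d → Fin d → ℝ)
    (hs : ∀ i j, h i j = h j i) (hU : ∑ k, U k k = 0) (hM : M = T + ∑ j, u j * a j) :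
    (ε / 2 * ∑ j, 2 * a j * Tk j + c * (F' * T))
      + ∑ k, (fv * U k k + u k * (ε / 2 * ∑ j, 2 * a j * h j k + c * (F' * a k)))
    = (-ε * ∑ k, h k k + c * F') * M
      + ∑ k, (ε * M * h k k + a k * (ε * (Tk k + ∑ j, (u j * h j k + a j * U j k))))
      - ε * ∑ i, ∑ j, a i * a j * U i j := by
  have e1 : ∑ k, (fv * U k k + u k * (ε / 2 * ∑ j, 2 * a j * h j k + c * (F' * a k)))
      = ε * ∑ k, ∑ j, u k * a j * h j k + c * F' * ∑ k, u k * a k := by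
    rw [Finset.sum_add_distrib, ← Finset.mul_sum, hU, mul_zero, zero_add, Finset.mul_sum,
      Finset.mul_sum, ← Finset.sum_add_distrib]
    refine Finset.sum_congr rfl fun k _ => ?_
    have : ∑ j, 2 * a j * h j k = 2 * ∑ j, a j * h j k := by
      rw [Finset.mul_sum]; exact Finset.sum_congr rfl fun j _ => by ring
    rw [this]
    have : ∑ j, u k * a j * h j k = u k * ∑ j, a j * h j k := by
      rw [Finset.mul_sum]; exact Finset.sum_congr rfl fun j _ => by ring
    rw [this]; ring
  have e2 : ∑ k, (ε * M * h k k + a k * (ε * (Tk k + ∑ j, (u j * h j k + a j * U j k))))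
      = ε * M * ∑ k, h k k + ε * ∑ k, a k * Tk k + ε * ∑ k, ∑ j, a k * u j * h j k
        + ε * ∑ k, ∑ j, a k * a j * U j k := by
    simp only [Finset.mul_sum, ← Finset.sum_add_distrib]
    refine Finset.sum_congr rfl fun k _ => ?_
    simp only [mul_add, Finset.mul_sum, Finset.sum_add_distrib]
    rw [← add_assoc, ← add_assoc]
    congr 1
    · congr 1
      · ring
      · exact Finset.sum_congr rfl fun j _ => by ring
    · exact Finset.sum_congr rfl fun j _ => by ring
  have e3 : ∑ k, ∑ j, a k * a j * U j k = ∑ i, ∑ j, a i * a j * U i j := by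
    rw [Finset.sum_comm]
    exact Finset.sum_congr rfl fun i _ => Finset.sum_congr rfl fun j _ => by ring
  have e4 : ∑ k, ∑ j, a k * u j * h j k = ∑ k, ∑ j, u k * a j * h j k := by
    rw [Finset.sum_comm]
    exact Finset.sum_congr rfl fun i _ => Finset.sum_congr rfl fun j _ => by rw [hs]; ring
  have e5 : ∑ j, 2 * a j * Tk j = 2 * ∑ j, a j * Tk j := by
    rw [Finset.mul_sum]; exact Finset.sum_congr rfl fun j _ => by ring
  rw [e1, e2, e3, e4, e5, hM]
  ring

/-- For a divergence-free velocity `u` and a phase-field `φ`, the Ginzburg–Landau free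
energy density `f = (ε/2)|∇φ|² + ε⁻¹ F(φ)` satisfies
`∂ₜ f + div(f u) = μ ∂ₜ•φ + div(ε ∂ₜ•φ ∇φ) − ε (∇φ ⊗ ∇φ) : ∇u` on `I × Ω`,
where `μ = −ε Δφ + ε⁻¹ F′(φ)` and `∂ₜ•φ = ∂ₜ φ + u · ∇φ`. -/
theorem stmt8 {d : ℕ} (Ω : Set (EuclideanSpace ℝ (Fin d))) (I : Set ℝ)
    (hΩ : IsOpen Ω) (hI : IsOpen I) (hIconn : I.OrdConnected)
    (ε : ℝ) (hε : 0 < ε) (F : ℝ → ℝ) (hF : ContDiff ℝ 1 F)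
    (u : ℝ × EuclideanSpace ℝ (Fin d) → EuclideanSpace ℝ (Fin d))
    (hu : ContDiffOn ℝ 1 u (I ×ˢ Ω))
    (hdivu : ∀ t ∈ I, ∀ x ∈ Ω, div' (fun k y => u (t, y) k) x = 0)
    (φ : ℝ × EuclideanSpace ℝ (Fin d) → ℝ)
    (hφ : ContDiffOn ℝ 2 φ (I ×ˢ Ω))
    (f μ mφ : ℝ → EuclideanSpace ℝ (Fin d) → ℝ)
    (hf : ∀ t y, f t y
      = ε / 2 * ∑ j, (pd j (fun z => φ (t, z)) y) ^ 2 + ε⁻¹ * F (φ (t, y)))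
    (hμ : ∀ t y, μ t y
      = -ε * lap' (fun z => φ (t, z)) y + ε⁻¹ * deriv F (φ (t, y)))
    (hmφ : ∀ t y, mφ t y
      = deriv (fun s => φ (s, y)) t + ∑ j, u (t, y) j * pd j (fun z => φ (t, z)) y) :
    ∀ t ∈ I, ∀ x ∈ Ω,
      deriv (fun s => f s x) t + div' (fun k y => f t y * u (t, y) k) x
        = μ t x * mφ t x
          + div' (fun k y => ε * mφ t y * pd k (fun z => φ (t, z)) y) x
          - ε * ∑ i, ∑ j,
              pd i (fun z => φ (t, z)) x * pd j (fun z => φ (t, z)) x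
                * pd j (fun y => u (t, y) i) x := by
  intro t ht x hx
  have hopen : IsOpen (I ×ˢ Ω) := hI.prod hΩ
  have hdφ : ∀ q ∈ I ×ˢ Ω, HasFDerivAt φ (fderiv ℝ φ q) q := fun q hq =>
    ((hφ.contDiffAt (hopen.mem_nhds hq)).differentiableAt (by norm_num)).hasFDerivAt
  have hp : (t, x) ∈ I ×ˢ Ω := ⟨ht, hx⟩
  have hφp : ContDiffAt ℝ 2 φ (t, x) := hφ.contDiffAt (hopen.mem_nhds hp)
  have hdu : HasFDerivAt u (fderiv ℝ u (t, x)) (t, x) :=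
    ((hu.contDiffAt (hopen.mem_nhds hp)).differentiableAt (by norm_num)).hasFDerivAt
  have hd2 : HasFDerivAt (fderiv ℝ φ) (fderiv ℝ (fderiv ℝ φ) (t, x)) (t, x) :=
    ((hφp.fderiv_right (m := 1) (by norm_num)).differentiableAt (by norm_num)).hasFDerivAt
  have hsymm : ∀ v w, fderiv ℝ (fderiv ℝ φ) (t, x) v w = fderiv ℝ (fderiv ℝ φ) (t, x) w v := by
    have := hφp.isSymmSndFDerivAt (by simp)
    exact fun v w => this v w
  set H := fderiv ℝ (fderiv ℝ φ) (t, x) with hH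
  let e : Fin d → ℝ × EuclideanSpace ℝ (Fin d) := fun k => (0, EuclideanSpace.single k 1)
  let e0 : ℝ × EuclideanSpace ℝ (Fin d) := (1, 0)
  -- first derivatives on the whole set
  have hP : ∀ s ∈ I, ∀ y ∈ Ω, ∀ j, pd j (fun z => φ (s, z)) y = fderiv ℝ φ (s, y) (e j) :=
    fun s hs y hy j => aux_pd φ _ s y (hdφ _ ⟨hs, hy⟩) j _ (Filter.Eventually.of_forall fun _ => rfl)
  have hT : ∀ s ∈ I, ∀ y ∈ Ω, deriv (fun r => φ (r, y)) s = fderiv ℝ φ (s, y) e0 :=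
    fun s hs y hy => aux_dt φ _ s y (hdφ _ ⟨hs, hy⟩) _ (Filter.Eventually.of_forall fun _ => rfl)
  have hI' : ∀ᶠ s in nhds t, s ∈ I := hI.mem_nhds ht
  have hΩ' : ∀ᶠ y in nhds x, y ∈ Ω := hΩ.mem_nhds hx
  -- derivatives of the building blocks
  have hDP : ∀ v : ℝ × EuclideanSpace ℝ (Fin d),
      HasFDerivAt (fun q => fderiv ℝ φ q v) (H.flip v) (t, x) := by
    intro v
    have := hd2.clm_apply (hasFDerivAt_const v (t, x))
    simpa using this
  have hDu : ∀ j, HasFDerivAt (fun q => u q j)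
      ((EuclideanSpace.proj j : EuclideanSpace ℝ (Fin d) →L[ℝ] ℝ).comp (fderiv ℝ u (t, x)))
      (t, x) := fun j =>
    (EuclideanSpace.proj j : EuclideanSpace ℝ (Fin d) →L[ℝ] ℝ).hasFDerivAt.comp (t, x) hdu
  have hDF : HasFDerivAt (fun q => F (φ q)) (deriv F (φ (t, x)) • fderiv ℝ φ (t, x)) (t, x) :=
    ((hF.differentiable (by norm_num)) (φ (t, x))).hasDerivAt.comp_hasFDerivAt (t, x) (hdφ _ hp)
  have hDf := ((HasFDerivAt.fun_sum (u := Finset.univ)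
    (fun j _ => (hDP (e j)).pow 2)).const_mul (ε / 2)).add (hDF.const_mul ε⁻¹)
  have hDm := (hDP e0).add (HasFDerivAt.fun_sum (u := Finset.univ)
    (fun j _ => (hDu j).mul (hDP (e j))))
  have hfe : ∀ s ∈ I, ∀ y ∈ Ω, f s y
      = ε / 2 * ∑ j, (fderiv ℝ φ (s, y) (e j)) ^ 2 + ε⁻¹ * F (φ (s, y)) := by
    intro s hs y hy
    rw [hf]; simp only [hP s hs y hy]
  have hme : ∀ s ∈ I, ∀ y ∈ Ω, mφ s y
      = fderiv ℝ φ (s, y) e0 + ∑ j, u (s, y) j * fderiv ℝ φ (s, y) (e j) := by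
    intro s hs y hy
    rw [hmφ, hT s hs y hy]; simp only [hP s hs y hy]
  have k1 := aux_dt _ _ t x hDf (fun s => f s x)
    (by filter_upwards [hI'] with s hs using hfe s hs x hx)
  have k2 := fun k => aux_pd _ _ t x (hDf.mul (hDu k)) k (fun y => f t y * u (t, y) k)
    (by filter_upwards [hΩ'] with y hy
        simp only [hfe t ht y hy, Pi.mul_apply, Pi.add_apply])
  have k3 := fun k => aux_pd _ _ t x ((hDm.const_mul ε).mul (hDP (e k))) k
    (fun y => ε * mφ t y * pd k (fun z => φ (t, z)) y)
    (by filter_upwards [hΩ'] with y hy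
        simp only [hme t ht y hy, hP t ht y hy, Pi.mul_apply, Pi.add_apply])
  have k4 := fun k => aux_pd _ _ t x (hDP (e k)) k (pd k (fun z => φ (t, z)))
    (by filter_upwards [hΩ'] with y hy using hP t ht y hy k)
  have k5 := fun i j => aux_pd _ _ t x (hDu i) j (fun y => u (t, y) i)
    (Filter.Eventually.of_forall fun _ => rfl)
  have hd0 := hdivu t ht x hx
  simp only [div', k5] at hd0
  have key := aux_alg ε ε⁻¹ (deriv F (φ (t, x))) (fderiv ℝ φ (t, x) e0) (mφ t x) (f t x)
    (fun j => fderiv ℝ φ (t, x) (e j)) (fun j => u (t, x) j) (fun j => H e0 (e j))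
    (fun j k => H (e k) (e j)) (fun i j => (fderiv ℝ u (t, x) (e j)) i)
    (fun i j => hsymm _ _) hd0 (hme t ht x hx)
  simp only [div', lap', hμ, k1, k2, k3, k4, k5, hP t ht x hx]
  have g1 := hfe t ht x hx
  have g2 := hme t ht x hx
  have z0 : ∀ j, H (e j) e0 = H e0 (e j) := fun j => hsymm _ _
  have hek : ∀ k, ((0, EuclideanSpace.single k 1) : ℝ × EuclideanSpace ℝ (Fin d)) = e k :=
    fun _ => rfl
  have he0 : ((1, 0) : ℝ × EuclideanSpace ℝ (Fin d)) = e0 := rfl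
  simp only [hek, he0, Pi.add_apply, Pi.mul_apply, ← g1, ← g2, ContinuousLinearMap.add_apply,
    ContinuousLinearMap.smul_apply, ContinuousLinearMap.sum_apply, ContinuousLinearMap.flip_apply,
    ContinuousLinearMap.comp_apply, PiLp.proj_apply, smul_eq_mul, nsmul_eq_mul,
    Nat.cast_ofNat, Nat.add_one_sub_one, pow_one, z0]
  exact key
end
end

section
/- Let d ∈ ℕ, let Ω ⊆ ℝ^d be open and let I ⊆ ℝ be an open interval. Let ε > 0 and ρ̃_1, ρ̃_2 > 0 be constants, let F, ν, m : ℝ → ℝ be smooth, and let u : I × Ω → ℝ^d, φ : I × Ω → ℝ, p : I × Ω → ℝ be smooth. Define ρ(φ) := ((ρ̃_2 − ρ̃_1)/2) φ + ((ρ̃_1 + ρ̃_2)/2), μ := −ε Δφ + ε⁻¹ F′(φ), J_φ := −m(φ) ∇μ, J := ((ρ̃_2 − ρ̃_1)/2) J_φ, Du := ½(∇u + (∇u)ᵀ), T := 2ν(φ) Du − p I − ε ∇φ ⊗ ∇φ, the energy density e := ½ ρ(φ)|u|² + (ε/2)|∇φ|² + ε⁻¹ F(φ), and the energy flux J_e :=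 ½|u|² J − Tᵀ u + μ J_φ − ε(∂_t φ + u·∇φ) ∇φ. Assume that on I × Ω: (i) div u = 0; (ii) ∂_t φ + div(φ u) = div(m(φ) ∇μ); (iii) ρ(φ) ∂_t u + (∇u)(ρ(φ) u + J) = div T. Then the local energy dissipation identity ∂_t e + div(e u + J_e) = −2ν(φ)|Du|² − m(φ)|∇μ|² holds on I × Ω. -/
noncomputable section

open scoped BigOperators

/-- Directional derivative of a space-time field. -/
def dd {d : ℕ} (v : ℝ × EuclideanSpace ℝ (Fin d)) (f : ℝ × EuclideanSpace ℝ (Fin d) → ℝ)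
    (q : ℝ × EuclideanSpace ℝ (Fin d)) : ℝ := fderiv ℝ f q v

/-- Smooth on a set. -/
def Sm {d : ℕ} (M : Set (ℝ × EuclideanSpace ℝ (Fin d)))
    (f : ℝ × EuclideanSpace ℝ (Fin d) → ℝ) : Prop := ContDiffOn ℝ (⊤ : ℕ∞) f M

/-- Spatial direction. -/
def sx {d : ℕ} (k : Fin d) : ℝ × EuclideanSpace ℝ (Fin d) := (0, EuclideanSpace.single k 1)

/-- Time direction. -/
def st {d : ℕ} : ℝ × EuclideanSpace ℝ (Fin d) := (1, 0)

section
variable {d : ℕ} {M : Set (ℝ × EuclideanSpace ℝ (Fin d))}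
  {f g : ℝ × EuclideanSpace ℝ (Fin d) → ℝ} {q v w : ℝ × EuclideanSpace ℝ (Fin d)}

theorem Sm.diff (hM : IsOpen M) (hf : Sm M f) (hq : q ∈ M) : DifferentiableAt ℝ f q :=
  (hf.contDiffAt (hM.mem_nhds hq)).differentiableAt (by simp)

theorem Sm.dd (hM : IsOpen M) (hf : Sm M f) (v) : Sm M (dd v f) := by
  have h : ContDiffOn ℝ (⊤ : ℕ∞) (fderiv ℝ f) M := hf.fderiv_of_isOpen hM (by simp)
  exact h.clm_apply contDiffOn_const

theorem Sm.add (hf : Sm M f) (hg : Sm M g) : Sm M (fun q => f q + g q) := ContDiffOn.add hf hg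
theorem Sm.sub (hf : Sm M f) (hg : Sm M g) : Sm M (fun q => f q - g q) := ContDiffOn.sub hf hg
theorem Sm.mul (hf : Sm M f) (hg : Sm M g) : Sm M (fun q => f q * g q) := ContDiffOn.mul hf hg
theorem Sm.const (c : ℝ) : Sm M (fun _ => c) := contDiffOn_const
theorem Sm.cmul (c : ℝ) (hf : Sm M f) : Sm M (fun q => c * f q) := (Sm.const c).mul hf
theorem Sm.sum {f : Fin d → ℝ × EuclideanSpace ℝ (Fin d) → ℝ} (hf : ∀ i, Sm M (f i)) :
    Sm M (fun q => ∑ i, f i q) := ContDiffOn.sum (fun i _ => hf i)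
theorem Sm.comp {F : ℝ → ℝ} (hF : ContDiff ℝ (⊤ : ℕ∞) F) (hf : Sm M f) :
    Sm M (fun q => F (f q)) := hF.comp_contDiffOn hf

theorem dd_add (hM : IsOpen M) (hq : q ∈ M) (hf : Sm M f) (hg : Sm M g) :
    dd v (fun q => f q + g q) q = dd v f q + dd v g q := by
  unfold dd
  rw [((hf.diff hM hq).hasFDerivAt.fun_add (hg.diff hM hq).hasFDerivAt).fderiv]; rfl
theorem dd_sub (hM : IsOpen M) (hq : q ∈ M) (hf : Sm M f) (hg : Sm M g) :
    dd v (fun q => f q - g q) q = dd v f q - dd v g q := by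
  unfold dd
  rw [((hf.diff hM hq).hasFDerivAt.fun_sub (hg.diff hM hq).hasFDerivAt).fderiv]; rfl
theorem dd_mul (hM : IsOpen M) (hq : q ∈ M) (hf : Sm M f) (hg : Sm M g) :
    dd v (fun q => f q * g q) q = f q * dd v g q + dd v f q * g q := by
  unfold dd
  rw [((hf.diff hM hq).hasFDerivAt.fun_mul (hg.diff hM hq).hasFDerivAt).fderiv]
  simp [mul_comm]
theorem dd_const (c : ℝ) : dd v (fun _ => c) q = 0 := by
  unfold dd; simp
theorem dd_cmul (hM : IsOpen M) (hq : q ∈ M) (c : ℝ) (hf : Sm M f) :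
    dd v (fun q => c * f q) q = c * dd v f q := by
  rw [dd_mul hM hq (Sm.const c) hf, dd_const]; ring
theorem dd_sum (hM : IsOpen M) (hq : q ∈ M) {f : Fin d → ℝ × EuclideanSpace ℝ (Fin d) → ℝ}
    (hf : ∀ i, Sm M (f i)) :
    dd v (fun q => ∑ i, f i q) q = ∑ i, dd v (f i) q := by
  unfold dd
  rw [(HasFDerivAt.fun_sum (fun i _ => ((hf i).diff hM hq).hasFDerivAt)).fderiv]
  simp
theorem dd_comp (hM : IsOpen M) (hq : q ∈ M) {F : ℝ → ℝ} (hF : ContDiff ℝ (⊤ : ℕ∞) F)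
    (hf : Sm M f) : dd v (fun q => F (f q)) q = deriv F (f q) * dd v f q := by
  unfold dd
  have h1 : HasDerivAt F (deriv F (f q)) (f q) :=
    (hF.differentiable (by simp) _).hasDerivAt
  have h2 : HasFDerivAt (fun q => F (f q)) (deriv F (f q) • fderiv ℝ f q) q :=
    h1.comp_hasFDerivAt q (hf.diff hM hq).hasFDerivAt
  rw [h2.fderiv]
  simp
theorem dd_comm (hM : IsOpen M) (hq : q ∈ M) (hf : Sm M f) :
    dd v (dd w f) q = dd w (dd v f) q := by
  have hc : ContDiffAt ℝ (⊤ : ℕ∞) f q := hf.contDiffAt (hM.mem_nhds hq)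
  have h : ContDiffOn ℝ (⊤ : ℕ∞) (fderiv ℝ f) M := hf.fderiv_of_isOpen hM (by simp)
  have hd : DifferentiableAt ℝ (fderiv ℝ f) q :=
    (h.contDiffAt (hM.mem_nhds hq)).differentiableAt (by simp)
  have hs : IsSymmSndFDerivAt ℝ f q := hc.isSymmSndFDerivAt (by
    simp only [minSmoothness_of_isRCLikeNormedField]
    exact WithTop.coe_le_coe.2 (le_top : (2 : ℕ∞) ≤ ⊤))
  have key : ∀ a b, dd a (dd b f) q = fderiv ℝ (fderiv ℝ f) q a b := by
    intro a b
    have := (hd.hasFDerivAt.clm_apply (hasFDerivAt_const b q)).fderiv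
    unfold dd
    rw [this]; simp
  rw [key, key, hs]

variable {I : Set ℝ} {Ω : Set (EuclideanSpace ℝ (Fin d))}

theorem pd_eq (hI : IsOpen I) (hΩ : IsOpen Ω) (hf : Sm (I ×ˢ Ω) f) {t : ℝ} (ht : t ∈ I)
    {g : EuclideanSpace ℝ (Fin d) → ℝ} (hg : ∀ y ∈ Ω, g y = f (t, y)) (k : Fin d) :
    ∀ x ∈ Ω, pd k g x = dd (sx k) f (t, x) := by
  intro x hx
  have he : g =ᶠ[nhds x] fun y => f (t, y) := Filter.eventuallyEq_of_mem (hΩ.mem_nhds hx) hg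
  have h1 := (hf.diff (hI.prod hΩ) (Set.mk_mem_prod ht hx)).hasFDerivAt
  have h2 : HasFDerivAt (fun y => f (t, y)) _ x := h1.comp x (hasFDerivAt_prodMk_right t x)
  unfold pd
  rw [he.fderiv_eq, h2.fderiv]
  simp [dd, sx]

theorem dt_eq (hI : IsOpen I) (hΩ : IsOpen Ω) (hf : Sm (I ×ˢ Ω) f)
    {x : EuclideanSpace ℝ (Fin d)} (hx : x ∈ Ω)
    {g : ℝ → ℝ} (hg : ∀ s ∈ I, g s = f (s, x)) :
    ∀ t ∈ I, deriv g t = dd st f (t, x) := by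
  intro t ht
  have he : g =ᶠ[nhds t] fun y => f (y, x) := Filter.eventuallyEq_of_mem (hI.mem_nhds ht) hg
  have h1 := (hf.diff (hI.prod hΩ) (Set.mk_mem_prod ht hx)).hasFDerivAt
  have h2 : HasFDerivAt (fun y => f (y, x)) _ t := h1.comp t (hasFDerivAt_prodMk_left t x)
  rw [he.deriv_eq, h2.hasDerivAt.deriv]
  simp [dd, st]
end

theorem alg {d : ℕ} (ε a r ie F' ph pht p mu nu mm E : ℝ)
    (u ut px ptx mx j jx : Fin d → ℝ) (ux pxx T Tx D : Fin d → Fin d → ℝ)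
    (hsym : ∀ i k, pxx i k = pxx k i)
    (hD : ∀ i k, D i k = 1 / 2 * (ux i k + ux k i))
    (hT : ∀ i k, T i k = 2 * nu * D i k - (if i = k then p else 0) - ε * px i * px k)
    (hj : ∀ k, j k = - mm * mx k)
    (hmu : mu = -ε * ∑ k, pxx k k + ie * F')
    (hdiv : ∑ k, ux k k = 0)
    (hCH : pht + ∑ k, (ph * ux k k + px k * u k) = - ∑ k, jx k)
    (hmom : ∀ i, r * ut i + ∑ k, ux i k * (r * u k + a * j k) = ∑ k, Tx i k) :
    (1 / 2 * (a * pht) * ∑ i, u i ^ 2 + r * ∑ i, u i * ut i + ε * ∑ i, px i * ptx i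
        + ie * (F' * pht))
      + ∑ k, ((E * ux k k + (1 / 2 * (a * px k) * ∑ i, u i ^ 2 + r * ∑ i, u i * ux i k
        + ε * ∑ i, px i * pxx i k + ie * (F' * px k)) * u k)
        + ((∑ i, u i * ux i k) * (a * j k) + 1 / 2 * (∑ i, u i ^ 2) * (a * jx k)
          - ∑ i, (T i k * ux i k + Tx i k * u i)
          + (mu * jx k + mx k * j k)
          - ε * ((pht + ∑ i, u i * px i) * pxx k k
            + (ptx k + ∑ i, (u i * pxx i k + ux i k * px i)) * px k)))
      = -(2 * nu * ∑ i, ∑ k, (D i k) ^ 2) - mm * ∑ k, (mx k) ^ 2 := by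
  have hmom' : r * ∑ i, u i * ut i + r * ∑ k, ∑ i, u i * ux i k * u k
      + a * ∑ k, ∑ i, u i * ux i k * j k = ∑ k, ∑ i, Tx i k * u i := by
    have : ∑ i, u i * (r * ut i + ∑ k, ux i k * (r * u k + a * j k)) = ∑ i, u i * ∑ k, Tx i k :=
      Finset.sum_congr rfl fun i _ => by rw [hmom]
    rw [Finset.sum_comm (f := fun k i => Tx i k * u i),
      Finset.sum_comm (f := fun k i => u i * ux i k * u k),
      Finset.sum_comm (f := fun k i => u i * ux i k * j k)]
    simp only [Finset.mul_sum] at this ⊢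
    simp only [← Finset.sum_add_distrib]
    calc _ = _ := ?_
      _ = _ := this
      _ = _ := ?_
    · refine Finset.sum_congr rfl fun i _ => ?_
      rw [mul_add, Finset.mul_sum, add_assoc, ← Finset.sum_add_distrib]
      congr 1
      · ring
      · exact Finset.sum_congr rfl fun k _ => by ring
    · exact Finset.sum_congr rfl fun i _ => Finset.sum_congr rfl fun k _ => by ring
  have hTu : ∑ k, ∑ i, T i k * ux i k
      = 2 * nu * ∑ i, ∑ k, (D i k) ^ 2 - ε * ∑ k, ∑ i, ux i k * px i * px k := by
    have h1 : ∑ k, ∑ i, D i k * ux i k = ∑ i, ∑ k, (D i k) ^ 2 := by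
      have h2 : ∑ k, ∑ i, D i k * ux i k = ∑ k, ∑ i, D i k * ux k i := by
        rw [Finset.sum_comm]
        refine Finset.sum_congr rfl fun i _ => Finset.sum_congr rfl fun k _ => ?_
        rw [hD, hD]; ring
      have h3 : ∑ i, ∑ k, (D i k) ^ 2
          = 1 / 2 * (∑ k, ∑ i, D i k * ux i k + ∑ k, ∑ i, D i k * ux k i) := by
        rw [Finset.sum_comm]
        simp only [← Finset.sum_add_distrib, Finset.mul_sum]
        refine Finset.sum_congr rfl fun i _ => Finset.sum_congr rfl fun k _ => ?_
        rw [pow_two]; nth_rewrite 2 [hD]; ring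
      rw [h3, ← h2]; ring
    have h4 : ∑ k, ∑ i, (if i = k then p else 0) * ux i k = 0 := by
      simp [← Finset.mul_sum, hdiv]
    rw [← h1]
    calc _ = 2 * nu * (∑ k, ∑ i, D i k * ux i k) - (∑ k, ∑ i, (if i = k then p else 0) * ux i k)
          - ε * ∑ k, ∑ i, ux i k * px i * px k := by
          simp only [← Finset.sum_sub_distrib, Finset.mul_sum]
          refine Finset.sum_congr rfl fun i _ => Finset.sum_congr rfl fun k _ => ?_
          rw [hT]; ring
      _ = _ := by rw [h4]; ring
  have hx : ∑ k, ∑ i, u i * pxx i k * px k = ∑ k, ∑ i, px i * pxx i k * u k := by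
    rw [Finset.sum_comm]
    refine Finset.sum_congr rfl fun i _ => Finset.sum_congr rfl fun k _ => ?_
    rw [hsym]; ring
  have hmj : ∑ k, mx k * j k = - mm * ∑ k, (mx k) ^ 2 := by
    rw [Finset.mul_sum]
    exact Finset.sum_congr rfl fun k _ => by rw [hj]; ring
  have hCH' : pht + ∑ k, u k * px k = - ∑ k, jx k := by
    rw [← hCH, Finset.sum_add_distrib, ← Finset.mul_sum, hdiv]
    simp [mul_comm]
  set U2 := ∑ i, u i ^ 2 with hU2
  set G := ∑ i, u i * px i with hG
  have hbig : ∑ k, ((E * ux k k + (1 / 2 * (a * px k) * U2 + r * ∑ i, u i * ux i k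
        + ε * ∑ i, px i * pxx i k + ie * (F' * px k)) * u k)
        + ((∑ i, u i * ux i k) * (a * j k) + 1 / 2 * U2 * (a * jx k)
          - ∑ i, (T i k * ux i k + Tx i k * u i)
          + (mu * jx k + mx k * j k)
          - ε * ((pht + G) * pxx k k
            + (ptx k + ∑ i, (u i * pxx i k + ux i k * px i)) * px k)))
      = E * (∑ k, ux k k) + 1 / 2 * a * U2 * G + r * (∑ k, ∑ i, u i * ux i k * u k)
        + ε * (∑ k, ∑ i, px i * pxx i k * u k) + ie * F' * G
        + a * (∑ k, ∑ i, u i * ux i k * j k) + 1 / 2 * U2 * a * (∑ k, jx k)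
        - (∑ k, ∑ i, T i k * ux i k) - (∑ k, ∑ i, Tx i k * u i)
        + mu * (∑ k, jx k) + (∑ k, mx k * j k)
        - ε * (pht + G) * (∑ k, pxx k k) - ε * (∑ k, px k * ptx k)
        - ε * (∑ k, ∑ i, u i * pxx i k * px k) - ε * (∑ k, ∑ i, ux i k * px i * px k) := by
    rw [show 1 / 2 * a * U2 * G = ∑ k, 1 / 2 * a * U2 * (u k * px k) by
      rw [hG, Finset.mul_sum], show ie * F' * G = ∑ k, ie * F' * (u k * px k) by
      rw [hG, Finset.mul_sum]]
    rw [Finset.mul_sum _ _ E, Finset.mul_sum _ _ r, Finset.mul_sum _ _ ε, Finset.mul_sum _ _ a,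
      Finset.mul_sum _ _ (1 / 2 * U2 * a), Finset.mul_sum _ _ mu,
      Finset.mul_sum _ _ (ε * (pht + G)), Finset.mul_sum _ _ ε, Finset.mul_sum _ _ ε,
      Finset.mul_sum _ _ ε]
    simp only [← Finset.sum_add_distrib, ← Finset.sum_sub_distrib]
    refine Finset.sum_congr rfl fun k _ => ?_
    simp only [Finset.sum_add_distrib, ← Finset.sum_mul]
    ring
  rw [hbig, hdiv, hTu, hx, hmj]
  have hs : ∑ k, jx k = -(pht + G) := by rw [hCH']; ring
  rw [hs, hmu]
  linear_combination hmom'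

/-- Local energy dissipation identity for the Abels–Garcke–Grün-type Navier–Stokes–
Cahn–Hilliard system: with `ρ(φ) = ((ρ̃₂−ρ̃₁)/2)φ + (ρ̃₁+ρ̃₂)/2`, `μ = −εΔφ + ε⁻¹F′(φ)`,
`J_φ = −m(φ)∇μ`, `J = ((ρ̃₂−ρ̃₁)/2)J_φ`, `Du = ½(∇u+(∇u)ᵀ)`, `T = 2ν(φ)Du − pI − ε∇φ⊗∇φ`,
`e = ½ρ(φ)|u|² + (ε/2)|∇φ|² + ε⁻¹F(φ)` and
`J_e = ½|u|²J − Tᵀu + μJ_φ − ε(∂ₜφ + u·∇φ)∇φ`, under (i) `div u = 0`,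
(ii) `∂ₜφ + div(φu) = div(m(φ)∇μ)` and (iii) `ρ(φ)∂ₜu + (∇u)(ρ(φ)u+J) = div T`, one has
`∂ₜ e + div(e u + J_e) = −2ν(φ)|Du|² − m(φ)|∇μ|²` on `I × Ω`. -/
theorem stmt9 {d : ℕ} (Ω : Set (EuclideanSpace ℝ (Fin d))) (I : Set ℝ)
    (hΩ : IsOpen Ω) (hI : IsOpen I) (hIconn : I.OrdConnected)
    (ε ρt₁ ρt₂ : ℝ) (hε : 0 < ε) (hρt₁ : 0 < ρt₁) (hρt₂ : 0 < ρt₂)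
    (F ν m : ℝ → ℝ) (hF : ContDiff ℝ (⊤ : ℕ∞) F) (hν : ContDiff ℝ (⊤ : ℕ∞) ν) (hm : ContDiff ℝ (⊤ : ℕ∞) m)
    (u : ℝ × EuclideanSpace ℝ (Fin d) → EuclideanSpace ℝ (Fin d))
    (φ p : ℝ × EuclideanSpace ℝ (Fin d) → ℝ)
    (hu : ContDiffOn ℝ (⊤ : ℕ∞) u (I ×ˢ Ω)) (hφ : ContDiffOn ℝ (⊤ : ℕ∞) φ (I ×ˢ Ω))
    (hp : ContDiffOn ℝ (⊤ : ℕ∞) p (I ×ˢ Ω))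
    (ρ : ℝ → ℝ) (hρ : ∀ s, ρ s = (ρt₂ - ρt₁) / 2 * s + (ρt₁ + ρt₂) / 2)
    (μ : ℝ → EuclideanSpace ℝ (Fin d) → ℝ)
    (hμ : ∀ t y, μ t y = -ε * lap' (fun z => φ (t, z)) y + ε⁻¹ * deriv F (φ (t, y)))
    (Jφ : ℝ → EuclideanSpace ℝ (Fin d) → Fin d → ℝ)
    (hJφ : ∀ t y k, Jφ t y k = -(m (φ (t, y))) * pd k (μ t) y)
    (J : ℝ → EuclideanSpace ℝ (Fin d) → Fin d → ℝ)
    (hJ : ∀ t y k, J t y k = (ρt₂ - ρt₁) / 2 * Jφ t y k)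
    (Du : ℝ → EuclideanSpace ℝ (Fin d) → Fin d → Fin d → ℝ)
    (hDu : ∀ t y i j, Du t y i j
      = 1 / 2 * (pd j (fun z => u (t, z) i) y + pd i (fun z => u (t, z) j) y))
    (T : ℝ → EuclideanSpace ℝ (Fin d) → Fin d → Fin d → ℝ)
    (hT : ∀ t y i j, T t y i j
      = 2 * ν (φ (t, y)) * Du t y i j - (if i = j then p (t, y) else 0)
        - ε * pd i (fun z => φ (t, z)) y * pd j (fun z => φ (t, z)) y)
    (e : ℝ → EuclideanSpace ℝ (Fin d) → ℝ)
    (he : ∀ t y, e t y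
      = 1 / 2 * ρ (φ (t, y)) * ‖u (t, y)‖ ^ 2
        + ε / 2 * ∑ j, (pd j (fun z => φ (t, z)) y) ^ 2 + ε⁻¹ * F (φ (t, y)))
    (Je : ℝ → EuclideanSpace ℝ (Fin d) → Fin d → ℝ)
    (hJe : ∀ t y k, Je t y k
      = 1 / 2 * ‖u (t, y)‖ ^ 2 * J t y k - ∑ i, T t y i k * u (t, y) i
        + μ t y * Jφ t y k
        - ε * (deriv (fun s => φ (s, y)) t
            + ∑ j, u (t, y) j * pd j (fun z => φ (t, z)) y)
          * pd k (fun z => φ (t, z)) y)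
    (hdivu : ∀ t ∈ I, ∀ x ∈ Ω, div' (fun k y => u (t, y) k) x = 0)
    (hCH : ∀ t ∈ I, ∀ x ∈ Ω,
      deriv (fun s => φ (s, x)) t + div' (fun k y => φ (t, y) * u (t, y) k) x
        = div' (fun k y => m (φ (t, y)) * pd k (μ t) y) x)
    (hmom : ∀ t ∈ I, ∀ x ∈ Ω, ∀ i : Fin d,
      ρ (φ (t, x)) * deriv (fun s => u (s, x) i) t
        + ∑ j, pd j (fun y => u (t, y) i) x * (ρ (φ (t, x)) * u (t, x) j + J t x j)
        = div' (fun k y => T t y i k) x) :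
    ∀ t ∈ I, ∀ x ∈ Ω,
      deriv (fun s => e s x) t + div' (fun k y => e t y * u (t, y) k + Je t y k) x
        = -(2 * ν (φ (t, x)) * ∑ i, ∑ j, (Du t x i j) ^ 2)
          - m (φ (t, x)) * ∑ k, (pd k (μ t) x) ^ 2 := by
  have hM : IsOpen (I ×ˢ Ω) := hI.prod hΩ
  have hρ' : ρ = fun s => (ρt₂ - ρt₁) / 2 * s + (ρt₁ + ρt₂) / 2 := funext hρ
  have sφ : Sm (I ×ˢ Ω) φ := hφ
  have sp : Sm (I ×ˢ Ω) p := hp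
  have su : ∀ i, Sm (I ×ˢ Ω) (fun q => u q i) := fun i => (contDiffOn_euclidean.1 hu) i
  have hF' : ContDiff ℝ (⊤ : ℕ∞) (deriv F) := by
    have : ContDiff ℝ ((⊤ : ℕ∞) + 1) F := by simpa using hF
    exact (contDiff_succ_iff_deriv.1 this).2.2
  have sρ : Sm (I ×ˢ Ω) (fun q => ρ (φ q)) := by
    rw [hρ']; exact (Sm.cmul _ sφ).add (Sm.const _)
  have dρ : ∀ v, ∀ q ∈ I ×ˢ Ω, dd v (fun q => ρ (φ q)) q = (ρt₂ - ρt₁) / 2 * dd v φ q := by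
    intro v q hq
    rw [hρ', dd_add hM hq (Sm.cmul _ sφ) (Sm.const _), dd_cmul hM hq _ sφ, dd_const, add_zero]
  -- spatial derivatives of φ
  have eφ : ∀ t ∈ I, ∀ y ∈ Ω, ∀ k, pd k (fun z => φ (t, z)) y = dd (sx k) φ (t, y) :=
    fun t ht y hy k => pd_eq hI hΩ sφ ht (fun _ _ => rfl) k y hy
  have eu : ∀ t ∈ I, ∀ y ∈ Ω, ∀ i k, pd k (fun z => u (t, z) i) y
      = dd (sx k) (fun q => u q i) (t, y) :=
    fun t ht y hy i k => pd_eq hI hΩ (su i) ht (fun _ _ => rfl) k y hy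
  have eφt : ∀ t ∈ I, ∀ y ∈ Ω, deriv (fun s => φ (s, y)) t = dd st φ (t, y) :=
    fun t ht y hy => dt_eq hI hΩ sφ hy (fun _ _ => rfl) t ht
  have eut : ∀ t ∈ I, ∀ y ∈ Ω, ∀ i, deriv (fun s => u (s, y) i) t
      = dd st (fun q => u q i) (t, y) :=
    fun t ht y hy i => dt_eq hI hΩ (su i) hy (fun _ _ => rfl) t ht
  have sφx : ∀ k, Sm (I ×ˢ Ω) (dd (sx k) φ) := fun k => sφ.dd hM _
  have sφt : Sm (I ×ˢ Ω) (dd st φ) := sφ.dd hM _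
  -- chemical potential
  let μh : ℝ × EuclideanSpace ℝ (Fin d) → ℝ := fun q =>
    -ε * ∑ k, dd (sx k) (dd (sx k) φ) q + ε⁻¹ * deriv F (φ q)
  have sμ : Sm (I ×ˢ Ω) μh :=
    (Sm.cmul _ (Sm.sum fun k => (sφx k).dd hM _)).add (Sm.cmul _ (Sm.comp hF' sφ))
  have eμ : ∀ t ∈ I, ∀ y ∈ Ω, μ t y = μh (t, y) := by
    intro t ht y hy
    rw [hμ]
    have : lap' (fun z => φ (t, z)) y = ∑ k, dd (sx k) (dd (sx k) φ) (t, y) :=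
      Finset.sum_congr rfl fun k _ =>
        pd_eq hI hΩ (sφx k) ht (fun z hz => eφ t ht z hz k) k y hy
    rw [this]
  have eμx : ∀ t ∈ I, ∀ y ∈ Ω, ∀ k, pd k (μ t) y = dd (sx k) μh (t, y) :=
    fun t ht y hy k => pd_eq hI hΩ sμ ht (eμ t ht) k y hy
  let jh : Fin d → ℝ × EuclideanSpace ℝ (Fin d) → ℝ := fun k q => -1 * (m (φ q) * dd (sx k) μh q)
  have smx : ∀ k, Sm (I ×ˢ Ω) (fun q => m (φ q) * dd (sx k) μh q) :=
    fun k => (Sm.comp hm sφ).mul (sμ.dd hM _)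
  have sj : ∀ k, Sm (I ×ˢ Ω) (jh k) := fun k => Sm.cmul _ (smx k)
  have ej : ∀ t ∈ I, ∀ y ∈ Ω, ∀ k, Jφ t y k = jh k (t, y) := by
    intro t ht y hy k
    rw [hJφ, eμx t ht y hy]; simp only [jh]; ring
  let Dh : Fin d → Fin d → ℝ × EuclideanSpace ℝ (Fin d) → ℝ := fun i k q =>
    1 / 2 * (dd (sx k) (fun q => u q i) q + dd (sx i) (fun q => u q k) q)
  have sD : ∀ i k, Sm (I ×ˢ Ω) (Dh i k) := fun i k =>
    Sm.cmul _ (((su i).dd hM _).add ((su k).dd hM _))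
  have eD : ∀ t ∈ I, ∀ y ∈ Ω, ∀ i k, Du t y i k = Dh i k (t, y) := by
    intro t ht y hy i k
    rw [hDu, eu t ht y hy, eu t ht y hy]
  let Th : Fin d → Fin d → ℝ × EuclideanSpace ℝ (Fin d) → ℝ := fun i k q =>
    2 * ν (φ q) * Dh i k q - (if i = k then p q else 0) - ε * dd (sx i) φ q * dd (sx k) φ q
  have sT : ∀ i k, Sm (I ×ˢ Ω) (Th i k) := fun i k => by
    refine Sm.sub (Sm.sub ((Sm.cmul _ (Sm.comp hν sφ)).mul (sD i k)) ?_)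
      ((Sm.cmul _ (sφx i)).mul (sφx k))
    by_cases h : i = k
    · simpa [h] using sp
    · simpa [h] using Sm.const 0
  have eT : ∀ t ∈ I, ∀ y ∈ Ω, ∀ i k, T t y i k = Th i k (t, y) := by
    intro t ht y hy i k
    rw [hT, eD t ht y hy, eφ t ht y hy, eφ t ht y hy]
  let U2 : ℝ × EuclideanSpace ℝ (Fin d) → ℝ := fun q => ∑ i, u q i * u q i
  have sU2 : Sm (I ×ˢ Ω) U2 := Sm.sum fun i => (su i).mul (su i)
  have eU2 : ∀ q, ‖u q‖ ^ 2 = U2 q := fun q => by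
    rw [EuclideanSpace.real_norm_sq_eq]; simp only [U2, pow_two]
  have dU2 : ∀ v, ∀ q ∈ I ×ˢ Ω, dd v U2 q = 2 * ∑ i, u q i * dd v (fun q => u q i) q := by
    intro v q hq
    rw [dd_sum hM hq fun i => (su i).mul (su i), Finset.mul_sum]
    refine Finset.sum_congr rfl fun i _ => ?_
    rw [dd_mul hM hq (su i) (su i)]; ring
  let P2 : ℝ × EuclideanSpace ℝ (Fin d) → ℝ := fun q => ∑ i, dd (sx i) φ q * dd (sx i) φ q
  have sP2 : Sm (I ×ˢ Ω) P2 := Sm.sum fun i => (sφx i).mul (sφx i)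
  have dP2 : ∀ v, ∀ q ∈ I ×ˢ Ω, dd v P2 q = 2 * ∑ i, dd (sx i) φ q * dd v (dd (sx i) φ) q := by
    intro v q hq
    rw [dd_sum hM hq fun i => (sφx i).mul (sφx i), Finset.mul_sum]
    refine Finset.sum_congr rfl fun i _ => ?_
    rw [dd_mul hM hq (sφx i) (sφx i)]; ring
  let eh : ℝ × EuclideanSpace ℝ (Fin d) → ℝ := fun q =>
    1 / 2 * ρ (φ q) * U2 q + ε / 2 * P2 q + ε⁻¹ * F (φ q)
  have s1 : Sm (I ×ˢ Ω) (fun q => 1 / 2 * ρ (φ q) * U2 q) := (Sm.cmul _ sρ).mul sU2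
  have s2 : Sm (I ×ˢ Ω) (fun q => ε / 2 * P2 q) := Sm.cmul _ sP2
  have s3 : Sm (I ×ˢ Ω) (fun q => ε⁻¹ * F (φ q)) := Sm.cmul _ (Sm.comp hF sφ)
  have se : Sm (I ×ˢ Ω) eh := (s1.add s2).add s3
  have ee : ∀ t ∈ I, ∀ y ∈ Ω, e t y = eh (t, y) := by
    intro t ht y hy
    rw [he, eU2]
    simp only [eφ t ht y hy, eh, P2, pow_two]
  have de : ∀ v, ∀ q ∈ I ×ˢ Ω, dd v eh q =
      1 / 2 * ((ρt₂ - ρt₁) / 2 * dd v φ q) * ∑ i, u q i ^ 2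
        + ρ (φ q) * ∑ i, u q i * dd v (fun q => u q i) q
        + ε * ∑ i, dd (sx i) φ q * dd v (dd (sx i) φ) q
        + ε⁻¹ * (deriv F (φ q) * dd v φ q) := by
    intro v q hq
    rw [dd_add hM hq (s1.add s2) s3, dd_add hM hq s1 s2, dd_mul hM hq (Sm.cmul _ sρ) sU2,
      dd_cmul hM hq _ sρ, dρ v q hq, dU2 v q hq, dd_cmul hM hq _ sP2, dP2 v q hq,
      dd_cmul hM hq _ (Sm.comp hF sφ), dd_comp hM hq hF sφ]
    simp only [U2, pow_two]; ring
  -- energy flux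
  let Dt : ℝ × EuclideanSpace ℝ (Fin d) → ℝ := fun q => dd st φ q + ∑ i, u q i * dd (sx i) φ q
  have sux : Sm (I ×ˢ Ω) (fun q => ∑ i, u q i * dd (sx i) φ q) :=
    Sm.sum fun i => (su i).mul (sφx i)
  have sDt : Sm (I ×ˢ Ω) Dt := sφt.add sux
  have dDt : ∀ v, ∀ q ∈ I ×ˢ Ω, dd v Dt q = dd v (dd st φ) q
      + ∑ i, (u q i * dd v (dd (sx i) φ) q + dd v (fun q => u q i) q * dd (sx i) φ q) := by
    intro v q hq
    rw [dd_add hM hq sφt sux, dd_sum hM hq fun i => (su i).mul (sφx i)]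
    congr 1
    exact Finset.sum_congr rfl fun i _ => dd_mul hM hq (su i) (sφx i)
  let Jh : Fin d → ℝ × EuclideanSpace ℝ (Fin d) → ℝ := fun k q =>
    1 / 2 * U2 q * ((ρt₂ - ρt₁) / 2 * jh k q) - ∑ i, Th i k q * u q i
      + μh q * jh k q - ε * (Dt q * dd (sx k) φ q)
  have t1 : ∀ k, Sm (I ×ˢ Ω) (fun q => 1 / 2 * U2 q * ((ρt₂ - ρt₁) / 2 * jh k q)) :=
    fun k => (Sm.cmul _ sU2).mul (Sm.cmul _ (sj k))
  have t2 : ∀ k, Sm (I ×ˢ Ω) (fun q => ∑ i, Th i k q * u q i) :=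
    fun k => Sm.sum fun i => (sT i k).mul (su i)
  have t3 : ∀ k, Sm (I ×ˢ Ω) (fun q => μh q * jh k q) := fun k => sμ.mul (sj k)
  have t4 : ∀ k, Sm (I ×ˢ Ω) (fun q => Dt q * dd (sx k) φ q) := fun k => sDt.mul (sφx k)
  have sJ : ∀ k, Sm (I ×ˢ Ω) (Jh k) := fun k =>
    (((t1 k).sub (t2 k)).add (t3 k)).sub (Sm.cmul _ (t4 k))
  have eJ : ∀ t ∈ I, ∀ y ∈ Ω, ∀ k, Je t y k = Jh k (t, y) := by
    intro t ht y hy k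
    rw [hJe, eU2, hJ, ej t ht y hy, eμ t ht y hy, eφt t ht y hy]
    simp only [eφ t ht y hy, eT t ht y hy, Jh, Dt]
    ring
  have dJ : ∀ k, ∀ q ∈ I ×ˢ Ω, dd (sx k) (Jh k) q =
      (∑ i, u q i * dd (sx k) (fun q => u q i) q) * ((ρt₂ - ρt₁) / 2 * jh k q)
        + 1 / 2 * (∑ i, u q i ^ 2) * ((ρt₂ - ρt₁) / 2 * dd (sx k) (jh k) q)
        - ∑ i, (Th i k q * dd (sx k) (fun q => u q i) q + dd (sx k) (Th i k) q * u q i)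
        + (μh q * dd (sx k) (jh k) q + dd (sx k) μh q * jh k q)
        - ε * ((dd st φ q + ∑ i, u q i * dd (sx i) φ q) * dd (sx k) (dd (sx k) φ) q
          + (dd (sx k) (dd st φ) q + ∑ i, (u q i * dd (sx k) (dd (sx i) φ) q
            + dd (sx k) (fun q => u q i) q * dd (sx i) φ q)) * dd (sx k) φ q) := by
    intro k q hq
    rw [dd_sub hM hq (((t1 k).sub (t2 k)).add (t3 k)) (Sm.cmul _ (t4 k)),
      dd_add hM hq ((t1 k).sub (t2 k)) (t3 k), dd_sub hM hq (t1 k) (t2 k),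
      dd_mul hM hq (Sm.cmul _ sU2) (Sm.cmul _ (sj k)), dd_cmul hM hq _ sU2,
      dd_cmul hM hq _ (sj k), dU2 _ q hq, dd_sum hM hq (fun i => (sT i k).mul (su i)),
      dd_mul hM hq sμ (sj k), dd_cmul hM hq _ (t4 k), dd_mul hM hq sDt (sφx k), dDt _ q hq]
    rw [Finset.sum_congr rfl fun i _ => dd_mul hM hq (sT i k) (su i)]
    simp only [U2, Dt, pow_two]; ring
  intro t ht x hx
  have hq : ((t, x) : ℝ × EuclideanSpace ℝ (Fin d)) ∈ I ×ˢ Ω := Set.mk_mem_prod ht hx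
  have hdivx := hdivu t ht x hx
  have hCHx := hCH t ht x hx
  have hmomx := hmom t ht x hx
  unfold div' at hdivx hCHx hmomx ⊢
  simp only [eu t ht x hx] at hdivx hmomx
  rw [eφt t ht x hx] at hCHx
  have c1 : ∀ k, pd k (fun y => φ (t, y) * u (t, y) k) x
      = φ (t, x) * dd (sx k) (fun q => u q k) (t, x) + dd (sx k) φ (t, x) * u (t, x) k := by
    intro k
    rw [pd_eq hI hΩ (sφ.mul (su k)) ht (fun _ _ => rfl) k x hx, dd_mul hM hq sφ (su k)]
  have c2 : ∀ k, pd k (fun y => m (φ (t, y)) * pd k (μ t) y) x = - dd (sx k) (jh k) (t, x) := by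
    intro k
    rw [pd_eq hI hΩ (smx k) ht (fun y hy => by rw [eμx t ht y hy]) k x hx,
      dd_cmul hM hq _ (smx k)]
    ring
  have c3 : ∀ i k, pd k (fun y => T t y i k) x = dd (sx k) (Th i k) (t, x) :=
    fun i k => pd_eq hI hΩ (sT i k) ht (fun y hy => eT t ht y hy i k) k x hx
  have c4 : ∀ k, pd k (fun y => e t y * u (t, y) k + Je t y k) x
      = (eh (t, x) * dd (sx k) (fun q => u q k) (t, x) + dd (sx k) eh (t, x) * u (t, x) k)
        + dd (sx k) (Jh k) (t, x) := by
    intro k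
    rw [pd_eq hI hΩ ((se.mul (su k)).add (sJ k)) ht
      (fun y hy => by rw [ee t ht y hy, eJ t ht y hy]) k x hx,
      dd_add hM hq (se.mul (su k)) (sJ k), dd_mul hM hq se (su k)]
  have c5 : deriv (fun s => e s x) t = dd st eh (t, x) :=
    dt_eq hI hΩ se hx (fun s hs => ee s hs x hx) t ht
  simp only [c1, c2, Finset.sum_neg_distrib] at hCHx
  simp only [c3, eut t ht x hx, hJ, ej t ht x hx] at hmomx
  simp only [c4, c5, de _ _ hq, dJ _ _ hq, eD t ht x hx, eμx t ht x hx]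
  have hcm : ∀ i, dd st (dd (sx i) φ) (t, x) = dd (sx i) (dd st φ) (t, x) :=
    fun i => dd_comm hM hq sφ
  simp only [hcm]
  exact alg ε ((ρt₂ - ρt₁) / 2) (ρ (φ (t, x))) ε⁻¹ (deriv F (φ (t, x))) (φ (t, x))
    (dd st φ (t, x)) (p (t, x)) (μh (t, x)) (ν (φ (t, x))) (m (φ (t, x))) (eh (t, x))
    (fun i => u (t, x) i) (fun i => dd st (fun q => u q i) (t, x))
    (fun i => dd (sx i) φ (t, x)) (fun i => dd (sx i) (dd st φ) (t, x))
    (fun k => dd (sx k) μh (t, x)) (fun k => jh k (t, x)) (fun k => dd (sx k) (jh k) (t, x))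
    (fun i k => dd (sx k) (fun q => u q i) (t, x))
    (fun i k => dd (sx k) (dd (sx i) φ) (t, x))
    (fun i k => Th i k (t, x)) (fun i k => dd (sx k) (Th i k) (t, x))
    (fun i k => Dh i k (t, x))
    (fun i k => dd_comm hM hq sφ) (fun i k => rfl) (fun i k => rfl)
    (fun k => by simp only [jh]; ring) rfl hdivx hCHx hmomx
end
end
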